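/- arXiv:2003.01205 — 3 statements merged into one kernel-verified Lean document; each statement's English description precedes it below -/
import Mathlib

section
/- Let G be a finite group, N a soluble normal subgroup of G, and x ∈ G. Then the cardinality of the set {yN : y ∈ Sol_G(x)} of cosets equals |Sol_G(x)| / |N|; equivalently, |Sol_G(x)| = |N| · |{yN : y ∈ Sol_G(x)}|. -/
theorem Subgroup.isSolvable_map_mk'_iff {G : Type*} [Group G] (N : Subgroup G) [N.Normal]
    (hN : Group.IsSolvable N) (H : Subgroup G) :
    Group.IsSolvable (H.map (QuotientGroup.mk' N)) ↔ Group.IsSolvable H := by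
  let q : H →* H.map (QuotientGroup.mk' N) := (QuotientGroup.mk' N).subgroupMap H
  constructor
  · intro _
    have : Group.IsSolvable (N.subgroupOf H) :=
      Group.isSolvable_of_isSolvable_injective
        (f := (H.subtype.comp (N.subgroupOf H).subtype).codRestrict N fun g => g.2)
        fun a b h => Subtype.ext (Subtype.ext (congrArg (fun n : N => (n : G)) h))
    refine Group.isSolvable_of_ker_le_range (N.subgroupOf H).subtype q fun g hg => ?_
    rw [Subgroup.range_subtype, Subgroup.mem_subgroupOf, ← QuotientGroup.eq_one_iff]
    exact congrArg Subtype.val (MonoidHom.mem_ker.mp hg)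
  · intro _
    exact Group.isSolvable_of_surjective ((QuotientGroup.mk' N).subgroupMap_surjective H)

theorem isSolvable_closure_pair_mk_iff {G : Type*} [Group G] (N : Subgroup G) [N.Normal]
    (hN : Group.IsSolvable N) (x g : G) :
    Group.IsSolvable (Subgroup.closure {(x : G ⧸ N), (g : G ⧸ N)}) ↔
      Group.IsSolvable (Subgroup.closure {x, g}) := by
  rw [← Subgroup.isSolvable_map_mk'_iff N hN, MonoidHom.map_closure, Set.image_pair]
  rfl

theorem stmt_6 (G : Type*) [Group G] [Finite G] (N : Subgroup G) [N.Normal]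
    (hN : IsSolvable N) (x : G) :
    ({g : G | IsSolvable (Subgroup.closure {x, g})} : Set G).ncard =
      Nat.card N *
        ((QuotientGroup.mk : G → G ⧸ N) ''
          {g : G | IsSolvable (Subgroup.closure {x, g})}).ncard := by
  have h : {g : G | IsSolvable (Subgroup.closure {x, g})} =
      (QuotientGroup.mk : G → G ⧸ N) ⁻¹'
        {y | Group.IsSolvable (Subgroup.closure {(x : G ⧸ N), y})} :=
    Set.ext fun g => (isSolvable_closure_pair_mk_iff N hN x g).symm
  rw [h, Set.image_preimage_eq _ QuotientGroup.mk_surjective]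
  exact QuotientGroup.card_preimage_mk N _
end

section
/- Let G be a finite group that is not soluble and let x ∈ G. Then the cardinality of Sol_G(x) is not a prime number. -/
open Subgroup in
/-- The join of a soluble subgroup with a soluble subgroup that it normalizes is soluble. -/
theorem isSolvable_sup_of_le_normalizer {G : Type*} [Group G] {H K : Subgroup G}
    (h : H ≤ normalizer (K : Set G)) [Group.IsSolvable H] [Group.IsSolvable K] :
    Group.IsSolvable (H ⊔ K : Subgroup G) := by
  have h₁ := normal_subgroupOf_sup_of_le_normalizer h
  have h₂ := normal_subgroupOf_of_le_normalizer h
  have h₃ : Group.IsSolvable (K.subgroupOf (H ⊔ K)) :=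
    Group.isSolvable_of_isSolvable_injective
      (f := (subgroupOfEquivOfLe (le_sup_right : K ≤ H ⊔ K)).toMonoidHom)
      (subgroupOfEquivOfLe (le_sup_right : K ≤ H ⊔ K)).injective
  have h₄ : Group.IsSolvable ((H ⊔ K : Subgroup G) ⧸ K.subgroupOf (H ⊔ K)) :=
    Group.isSolvable_of_surjective
      (f := (QuotientGroup.quotientInfEquivProdNormalizerQuotient H K h).toMonoidHom)
      (QuotientGroup.quotientInfEquivProdNormalizerQuotient H K h).surjective
  exact (Group.isSolvable_iff_subgroup_quotient (K.subgroupOf (H ⊔ K))).2 ⟨h₃, h₄⟩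

theorem isSolvable_of_le {G : Type*} [Group G] {H K : Subgroup G} (h : H ≤ K)
    [Group.IsSolvable K] : Group.IsSolvable H :=
  Group.isSolvable_of_isSolvable_injective (Subgroup.inclusion_injective h)

theorem isSolvable_zpowers {G : Type*} [Group G] (x : G) :
    Group.IsSolvable (Subgroup.zpowers x) :=
  Group.isSolvable_of_comm fun a b => mul_comm' a b

open scoped Pointwise in
/-- The order of `x` divides the cardinality of its solubilizer. -/
theorem orderOf_dvd_ncard_solubilizer {G : Type*} [Group G] (x : G) :
    orderOf x ∣ {g : G | Group.IsSolvable (Subgroup.closure {x, g})}.ncard := by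
  set S := {g : G | Group.IsSolvable (Subgroup.closure {x, g})}
  have h : S * (Subgroup.zpowers x : Set G) = S := by
    refine Set.Subset.antisymm ?_ fun g hg => ⟨g, hg, 1, one_mem _, mul_one g⟩
    rintro _ ⟨g, hg, c, hc, rfl⟩
    have hg' : Group.IsSolvable (Subgroup.closure {x, g}) := hg
    have hx : x ∈ Subgroup.closure {x, g} := Subgroup.subset_closure (by simp)
    refine isSolvable_of_le (K := Subgroup.closure {x, g}) ((Subgroup.closure_le _).2 ?_)
    rintro _ (rfl | rfl)
    · exact hx
    · exact mul_mem (Subgroup.subset_closure (by simp)) (Subgroup.zpowers_le.2 hx hc)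
  have hcard := Subgroup.card_mul_eq_card_subgroup_mul_card_quotient (Subgroup.zpowers x) S
  rw [h, Nat.card_zpowers] at hcard
  exact ⟨_, hcard⟩

open Subgroup in
/-- If the group generated by `x` and `g` is insoluble for every `g` outside `zpowers x`, and `x`
has prime order, then the whole group is soluble. -/
theorem isSolvable_of_solubilizer_subset_zpowers {G : Type*} [Group G] [Finite G] {x : G} {p : ℕ}
    [hp : Fact p.Prime] (hx : orderOf x = p)
    (h : ∀ g : G, Group.IsSolvable (closure {x, g}) → g ∈ zpowers x) : Group.IsSolvable G := by
  have hnorm : normalizer (zpowers x : Set G) ≤ zpowers x := by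
    intro g hg
    have := isSolvable_zpowers x
    have := isSolvable_zpowers g
    have := isSolvable_sup_of_le_normalizer (zpowers_le.2 hg)
    refine h g (isSolvable_of_le (K := zpowers g ⊔ zpowers x) ((closure_le _).2 ?_))
    rintro _ (rfl | rfl)
    · exact mem_sup_right (mem_zpowers _)
    · exact mem_sup_left (mem_zpowers _)
  have hcard : Nat.card (zpowers x) = p := by rw [Nat.card_zpowers, hx]
  have hsq : ¬ p ^ 2 ∣ Nat.card G := by
    intro hdvd
    have hmod := Sylow.card_normalizer_modEq_card (p := p) (n := 1) (H := zpowers x)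
      (by rw [hcard, pow_one])
    have h₁ : p ^ 2 ∣ Nat.card (normalizer (zpowers x : Set G)) :=
      (hmod.dvd_iff dvd_rfl).2 hdvd
    have h₂ := h₁.trans (card_dvd_of_le hnorm)
    rw [hcard] at h₂
    have := Nat.le_of_dvd hp.out.pos h₂
    nlinarith [hp.out.two_le]
  have hfact : (Nat.card G).factorization p = 1 := by
    apply le_antisymm
    · by_contra! hlt
      exact hsq ((pow_dvd_pow p hlt).trans (Nat.ordProj_dvd _ _))
    · exact (hp.out.dvd_iff_one_le_factorization Nat.card_pos.ne').1
        (hcard ▸ card_subgroup_dvd_card (zpowers x))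
  let P : Sylow p G := Sylow.ofCard (zpowers x) (by rw [hcard, hfact, pow_one])
  have hP : normalizer P ≤ centralizer (P : Set G) :=
    hnorm.trans (le_centralizer (zpowers x))
  let f := MonoidHom.transferSylow P hP
  have hcompl : IsComplement' f.ker (zpowers x) := MonoidHom.ker_transferSylow_isComplement' P hP
  have hpker : ¬ p ∣ Nat.card f.ker := MonoidHom.not_dvd_card_ker_transferSylow P hP
  by_cases hone : Nat.card f.ker = 1
  · have := isSolvable_zpowers x
    rw [card_eq_one.1 hone, isComplement'_bot_left] at hcompl
    rw [hcompl] at this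
    exact Group.isSolvable_of_surjective (f := (topEquiv (G := G)).toMonoidHom) topEquiv.surjective
  obtain ⟨q, hq, hqker⟩ := Nat.exists_prime_and_dvd hone
  have := Fact.mk hq
  obtain ⟨Q⟩ : Nonempty (Sylow q f.ker) := inferInstance
  set R := (Q : Subgroup f.ker).map f.ker.subtype with hR
  have hRp : IsPGroup q R := Q.isPGroup'.map _
  have hRcard : q ∣ Nat.card R := by
    rw [hR, card_map_of_injective f.ker.subtype_injective]
    exact Q.dvd_card_of_dvd_card hqker
  have hfrattini : normalizer (R : Set G) ⊔ f.ker = ⊤ := Sylow.normalizer_sup_eq_top Q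
  have hpR : p ∣ Nat.card (normalizer (R : Set G)) := by
    have hindex := relIndex_sup_right (normalizer (R : Set G)) f.ker
    rw [hfrattini, relIndex_top_right, hcompl.symm.index_eq_card, hcard] at hindex
    exact hindex ▸ relIndex_dvd_card _ _
  obtain ⟨⟨y, hyR⟩, hy⟩ := exists_prime_orderOf_dvd_card' p hpR
  rw [orderOf_mk] at hy
  let Y : Sylow p G := Sylow.ofCard (zpowers y) (by rw [Nat.card_zpowers, hy, hfact, pow_one])
  obtain ⟨g, hg⟩ := MulAction.exists_smul_eq G Y P
  have hxg : x ∈ (zpowers y).map (MulAut.conj g).toMonoidHom := by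
    have : x ∈ g • Y := hg ▸ mem_zpowers x
    exact this
  obtain ⟨⟨z, hzR⟩, hz⟩ := exists_prime_orderOf_dvd_card' q hRcard
  rw [orderOf_mk] at hz
  have hsol : Group.IsSolvable (zpowers y ⊔ R : Subgroup G) := by
    have := isSolvable_zpowers y
    have := hRp.isNilpotent
    exact isSolvable_sup_of_le_normalizer (zpowers_le.2 hyR)
  have hmem : MulAut.conj g z ∈ zpowers x := by
    have : Group.IsSolvable ((zpowers y ⊔ R).map (MulAut.conj g).toMonoidHom) :=
      Group.isSolvable_of_surjective
        (MonoidHom.subgroupMap_surjective (MulAut.conj g).toMonoidHom (zpowers y ⊔ R))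
    refine h _ (isSolvable_of_le (K := (zpowers y ⊔ R).map (MulAut.conj g).toMonoidHom)
      ((closure_le _).2 ?_))
    rintro _ (rfl | rfl)
    · exact map_mono le_sup_left hxg
    · exact mem_map_of_mem _ (mem_sup_right hzR)
  have hqp : q ∣ p := by
    rw [← hz, ← (MulAut.conj g).orderOf_eq z, ← hcard]
    exact orderOf_dvd_natCard _ hmem
  rw [(Nat.prime_dvd_prime_iff_eq hq hp.out).1 hqp] at hqker
  exact (hpker hqker).elim

theorem stmt_11 (G : Type*) [Group G] [Finite G] (hG : ¬ IsSolvable G) (x : G) :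
    ¬ Nat.Prime (({g : G | IsSolvable (Subgroup.closure {x, g})} : Set G).ncard) := by
  intro hprime
  apply hG
  have hdvd := orderOf_dvd_ncard_solubilizer x
  set S := {g : G | Group.IsSolvable (Subgroup.closure {x, g})}
  have hprime' : S.ncard.Prime := hprime
  rcases (Nat.dvd_prime hprime').1 hdvd with h₁ | h₁
  · have hSuniv : S = Set.univ := by
      refine Set.eq_univ_of_forall fun g => ?_
      have := isSolvable_zpowers g
      refine isSolvable_of_le (K := Subgroup.zpowers g) ((Subgroup.closure_le _).2 ?_)
      rintro _ (rfl | rfl)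
      · rw [orderOf_eq_one_iff.1 h₁]
        exact one_mem _
      · exact Subgroup.mem_zpowers _
    rw [hSuniv, Set.ncard_univ] at hprime'
    have := Fact.mk hprime'
    have := (IsPGroup.of_card (p := Nat.card G) (pow_one _).symm).isNilpotent
    exact IsNilpotent.to_isSolvable
  · have := Fact.mk hprime'
    refine isSolvable_of_solubilizer_subset_zpowers h₁ fun g hg => ?_
    have hsub : (Subgroup.zpowers x : Set G) ⊆ S := fun g hg => by
      have := isSolvable_zpowers x
      refine isSolvable_of_le (K := Subgroup.zpowers x) ((Subgroup.closure_le _).2 ?_)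
      rintro _ (rfl | rfl)
      · exact Subgroup.mem_zpowers _
      · exact hg
    have heq : (Subgroup.zpowers x : Set G) = S := by
      refine Set.eq_of_subset_of_ncard_le hsub ?_ (Set.toFinite _)
      rw [← h₁, ← Nat.card_zpowers]
      exact le_rfl
    exact heq.ge hg
end

section
/- Let G be a finite group that is not soluble and suppose G has a nontrivial soluble normal subgroup (equivalently, the soluble radical R(G) is nontrivial). Then for every x ∈ G, the cardinality of Sol_G(x) is not the square of a prime number. -/
open Subgroup

/-- A subgroup is soluble if its image under a homomorphism with soluble kernel is. -/
theorem Subgroup.isSolvable_of_isSolvable_map {G G' : Type*} [Group G] [Group G'] (f : G →* G')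
    (hf : Group.IsSolvable f.ker) (H : Subgroup G) (hH : Group.IsSolvable (H.map f)) :
    Group.IsSolvable H := by
  have hker : Group.IsSolvable (f.subgroupMap H).ker := by
    let j : (f.subgroupMap H).ker →* f.ker :=
      (H.subtype.comp (f.subgroupMap H).ker.subtype).codRestrict f.ker fun a => by
        have := congrArg Subtype.val (MonoidHom.mem_ker.1 a.2)
        simpa using this
    refine Group.isSolvable_of_isSolvable_injective (f := j) fun a b hab => ?_
    have := congrArg Subtype.val hab
    exact Subtype.ext (Subtype.ext this)
  exact Group.isSolvable_of_ker_le_range (f.subgroupMap H).ker.subtype (f.subgroupMap H) (by simp)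

/-- If `N` is a soluble normal subgroup, then `⟨x, g⟩` is soluble iff its image in `G ⧸ N` is. -/
theorem isSolvable_closure_pair_quotient_iff {G : Type*} [Group G] (N : Subgroup G) [N.Normal]
    (hN : Group.IsSolvable N) (x g : G) :
    Group.IsSolvable (closure {(x : G ⧸ N), (g : G ⧸ N)}) ↔ Group.IsSolvable (closure {x, g}) := by
  have hmap : (closure {x, g}).map (QuotientGroup.mk' N) = closure {(x : G ⧸ N), (g : G ⧸ N)} := by
    rw [MonoidHom.map_closure, Set.image_pair]; rfl
  rw [← hmap]
  refine ⟨isSolvable_of_isSolvable_map _ (by rwa [QuotientGroup.ker_mk']) _, fun h => ?_⟩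
  exact Group.isSolvable_of_surjective ((QuotientGroup.mk' N).subgroupMap_surjective _)

/-- If `x` normalizes a soluble subgroup `A` and `g ∈ A`, then `⟨x, g⟩` is soluble. -/
theorem isSolvable_closure_pair_of_mem_normalizer {G : Type*} [Group G] (A : Subgroup G)
    (hA : Group.IsSolvable A) {x g : G} (hx : x ∈ normalizer (A : Set G)) (hg : g ∈ A) :
    Group.IsSolvable (closure {x, g}) := by
  let M := normalizer (A : Set G)
  let B : Subgroup M := A.subgroupOf M
  have hB : Group.IsSolvable B :=
    let e : B ≃* A := subgroupOfEquivOfLe le_normalizer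
    Group.isSolvable_of_isSolvable_injective (f := e.toMonoidHom) e.injective
  let g' : M := ⟨g, le_normalizer hg⟩
  let x' : M := ⟨x, hx⟩
  have hg' : (g' : M ⧸ B) = 1 := (QuotientGroup.eq_one_iff _).2 (mem_subgroupOf.2 hg)
  have h1 : Group.IsSolvable (closure {x', g'}) := by
    rw [← isSolvable_closure_pair_quotient_iff B hB, hg', Set.pair_comm, closure_insert_one,
      ← zpowers_eq_closure]
    exact Group.isSolvable_of_comm mul_comm'
  have hmap : (closure {x', g'}).map M.subtype = closure {x, g} := by
    rw [MonoidHom.map_closure, Set.image_pair]; rfl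
  rw [← hmap]
  exact Group.isSolvable_of_surjective (M.subtype.subgroupMap_surjective _)

/-- The order of `y` divides the cardinality of its solubilizer. -/
theorem card_zpowers_dvd_ncard_solubilizer {H : Type*} [Group H] (y : H) :
    Nat.card (zpowers y) ∣ {g : H | Group.IsSolvable (closure {y, g})}.ncard := by
  set S := {g : H | Group.IsSolvable (closure {y, g})}
  have hpre : (QuotientGroup.mk : H → H ⧸ zpowers y) ⁻¹' (QuotientGroup.mk '' S) = S := by
    refine Set.Subset.antisymm ?_ (Set.subset_preimage_image _ _)
    rintro g ⟨s, hs, hsg⟩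
    have hle : closure {y, g} ≤ closure {y, s} := by
      have hy : y ∈ closure {y, s} := subset_closure (by simp)
      have hs' : s ∈ closure {y, s} := subset_closure (by simp)
      rw [closure_le, Set.pair_subset_iff]
      refine ⟨hy, ?_⟩
      have := mul_mem hs' ((zpowers_le.2 hy) (QuotientGroup.eq.1 hsg))
      simpa using this
    have hs : Group.IsSolvable (closure {y, s}) := hs
    exact Group.isSolvable_of_isSolvable_injective (inclusion_injective hle)
  rw [← Nat.card_coe_set_eq, ← hpre, QuotientGroup.card_preimage_mk]
  exact dvd_mul_right _ _

/-- A subgroup of prime order `p` equal to its normalizer is a Sylow `p`-subgroup. -/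
theorem exists_sylow_eq_of_normalizer_eq {H : Type*} [Group H] [Finite H] {p : ℕ} [Fact p.Prime]
    (Z : Subgroup H) (hZ : Nat.card Z = p) (hn : normalizer (Z : Set H) = Z) :
    ∃ P : Sylow p H, (P : Subgroup H) = Z := by
  have hp : p.Prime := Fact.out
  have hnd : ¬ p ^ 2 ∣ Nat.card H := fun h => by
    have := Sylow.prime_pow_dvd_card_normalizer (n := 1) h (H := Z) (by simpa using hZ)
    rw [hn, hZ] at this
    have := Nat.le_of_dvd hp.pos this
    rw [one_add_one_eq_two] at this
    nlinarith [hp.two_le]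
  have hd : p ∣ Nat.card H := hZ ▸ Z.card_subgroup_dvd_card
  have hf : (Nat.card H).factorization p = 1 := by
    have h1 := (hp.pow_dvd_iff_le_factorization (k := 1) Nat.card_pos.ne').1 (by simpa using hd)
    have h2 := (hp.pow_dvd_iff_le_factorization (k := 2) Nat.card_pos.ne').not.1 hnd
    omega
  exact ⟨Sylow.ofCard Z (by rw [hf, hZ, pow_one]), rfl⟩

open scoped Pointwise in
/-- A `p`-element normalizes some Sylow `q`-subgroup of any normal subgroup of order prime to
`p`. -/
theorem exists_sylow_normalized {H : Type*} [Group H] [Finite H] {p : ℕ} [Fact p.Prime]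
    (q : ℕ) [Fact q.Prime] (K : Subgroup H) [K.Normal] (hK : ¬ p ∣ Nat.card K) {y : H}
    (hy : IsPGroup p (zpowers y)) :
    ∃ Q : Sylow q K, y ∈ normalizer (((Q : Subgroup K).map K.subtype : Subgroup H) : Set H) := by
  let c : ConjAct H := ConjAct.toConjAct y
  have hc : IsPGroup p (zpowers c) := by
    have : zpowers c = (zpowers y).map (ConjAct.toConjAct : H ≃* ConjAct H).toMonoidHom := by
      rw [MonoidHom.map_zpowers]; rfl
    rw [this]
    exact hy.map _
  have hnd : ¬ p ∣ Nat.card (Sylow q K) := fun h =>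
    hK (h.trans ((Sylow.card_dvd_index default).trans (index_dvd_card _)))
  obtain ⟨Q, hQ⟩ := hc.nonempty_fixed_point_of_prime_not_dvd_card (Sylow q K) hnd
  refine ⟨Q, ?_⟩
  have hfix : c • (Q : Subgroup K) = Q := congrArg Sylow.toSubgroup (hQ ⟨c, mem_zpowers c⟩)
  have key : ∀ k : K, k ∈ (Q : Subgroup K) ↔ c • k ∈ (Q : Subgroup K) := fun k => by
    conv_rhs => rw [← hfix]
    exact (smul_mem_pointwise_smul_iff).symm
  rw [mem_normalizer_iff]
  intro h
  constructor
  · rintro ⟨k, hk, rfl⟩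
    exact ⟨c • k, (key k).1 hk, rfl⟩
  · rintro ⟨k, hk, hkh⟩
    refine ⟨c⁻¹ • k, (key _).2 (by rwa [smul_inv_smul]), ?_⟩
    have hkh : (k : H) = y * h * y⁻¹ := hkh
    have : ((c⁻¹ • k : K) : H) = y⁻¹ * k * y := by
      simp [c, ConjAct.Subgroup.val_conj_smul, ConjAct.smul_def]
    simp [this, hkh, mul_assoc]

/-- A finite group having an element whose solubilizer has cardinality dividing a prime is
soluble. -/
theorem isSolvable_of_ncard_solubilizer_dvd_prime {H : Type*} [Group H] [Finite H] {p : ℕ}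
    (hp : p.Prime) (y : H) (h : {g : H | Group.IsSolvable (closure {y, g})}.ncard ∣ p) :
    Group.IsSolvable H := by
  have : Fact p.Prime := ⟨hp⟩
  have hdvd := card_zpowers_dvd_ncard_solubilizer y
  set S := {g : H | Group.IsSolvable (closure {y, g})}
  have of_pGroup (hH : IsPGroup p H) : Group.IsSolvable H :=
    have := hH.isNilpotent
    inferInstance
  rcases (Nat.dvd_prime hp).1 (hdvd.trans h) with h1 | hZ
  · have hy : y = 1 := by
      rw [Nat.card_zpowers] at h1
      exact orderOf_eq_one_iff.1 h1
    have hSuniv : S = Set.univ := Set.eq_univ_of_forall fun g => by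
      show Group.IsSolvable (closure {y, g})
      rw [hy, closure_insert_one, ← zpowers_eq_closure]
      infer_instance
    rw [hSuniv, Set.ncard_univ] at h
    exact of_pGroup (IsPGroup.iff_card.2 (by
      rcases (Nat.dvd_prime hp).1 h with h | h
      · exact ⟨0, by simpa using h⟩
      · exact ⟨1, by simpa using h⟩))
  have hSZ : ∀ g ∈ S, g ∈ zpowers y := by
    have hsub : ((zpowers y : Subgroup H) : Set H) ⊆ S := fun g hg =>
      isSolvable_closure_pair_of_mem_normalizer _ inferInstance
        (le_normalizer (mem_zpowers y)) hg
    have := Set.eq_of_subset_of_ncard_le hsub (by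
      rw [← Nat.card_coe_set_eq ((zpowers y : Subgroup H) : Set H)]
      exact (Nat.le_of_dvd hp.pos h).trans hZ.ge)
    intro g hg
    rwa [← this] at hg
  have hnorm : normalizer ((zpowers y : Subgroup H) : Set H) = zpowers y :=
    le_antisymm (fun g hg => hSZ g <| by
      show Group.IsSolvable (closure {y, g})
      rw [Set.pair_comm]
      exact isSolvable_closure_pair_of_mem_normalizer _ inferInstance hg (mem_zpowers y))
      le_normalizer
  obtain ⟨P, hP⟩ := exists_sylow_eq_of_normalizer_eq (zpowers y) hZ hnorm
  have hPc : normalizer ((P : Subgroup H) : Set H) ≤ centralizer ((P : Subgroup H) : Set H) := by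
    rw [hP, hnorm]
    exact le_centralizer _
  set K := (MonoidHom.transferSylow P hPc).ker
  have hKc : ¬ p ∣ Nat.card K := MonoidHom.not_dvd_card_ker_transferSylow P hPc
  have hcompl : IsComplement' K P := MonoidHom.ker_transferSylow_isComplement' P hPc
  have hK1 : Nat.card K = 1 := by
    by_contra hne
    obtain ⟨q, hq, hqK⟩ := Nat.exists_prime_and_dvd hne
    have : Fact q.Prime := ⟨hq⟩
    obtain ⟨Q, hQ⟩ := exists_sylow_normalized q K hKc (hP ▸ P.2 : IsPGroup p (zpowers y))
    have hQsol : Group.IsSolvable ((Q : Subgroup K).map K.subtype) := by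
      have := (Q.2.map K.subtype).isNilpotent
      infer_instance
    have hQbot : (Q : Subgroup K) = ⊥ := by
      rw [eq_bot_iff]
      intro k hk
      have hkS := hSZ (k : H)
        (isSolvable_closure_pair_of_mem_normalizer _ hQsol hQ (mem_map_of_mem K.subtype hk))
      rw [← hP] at hkS
      have : (k : H) ∈ (⊥ : Subgroup H) := hcompl.disjoint.le_bot ⟨k.2, hkS⟩
      exact Subtype.ext (by simpa using this)
    exact Q.ne_bot_of_dvd_card hqK hQbot
  refine of_pGroup (IsPGroup.iff_card.2 ⟨1, ?_⟩)
  rw [← hcompl.card_mul_card, hK1, hP, hZ, one_mul, pow_one]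

theorem stmt_12 (G : Type*) [Group G] [Finite G] (hG : ¬ IsSolvable G)
    (hR : ∃ N : Subgroup G, N.Normal ∧ IsSolvable N ∧ N ≠ ⊥) (x : G) :
    ¬ ∃ p : ℕ, Nat.Prime p ∧
      ({g : G | IsSolvable (Subgroup.closure {x, g})} : Set G).ncard = p ^ 2 := by
  rintro ⟨p, hp, hcard⟩
  obtain ⟨N, hNn, hNs, hN⟩ := hR
  apply hG
  set T := {g : G ⧸ N | Group.IsSolvable (closure {(x : G ⧸ N), g})}
  have hpre : {g : G | Group.IsSolvable (closure {x, g})} = QuotientGroup.mk ⁻¹' T := by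
    ext g
    exact (isSolvable_closure_pair_quotient_iff N hNs x g).symm
  have hmul : Nat.card N * T.ncard = p ^ 2 := by
    rw [← Nat.card_coe_set_eq T, ← QuotientGroup.card_preimage_mk, ← hpre, Nat.card_coe_set_eq]
    exact hcard
  have hN1 : Nat.card N ≠ 1 := fun h => hN (card_eq_one.1 h)
  have hTp : T.ncard ∣ p := by
    obtain ⟨i, hi, hNi⟩ := (Nat.dvd_prime_pow hp).1 (Dvd.intro _ hmul)
    have hi0 : i ≠ 0 := by rintro rfl; exact hN1 (by simpa using hNi)
    obtain ⟨j, rfl⟩ := Nat.exists_eq_succ_of_ne_zero hi0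
    have h2 : p ^ j * T.ncard = p := by
      rw [hNi] at hmul
      refine Nat.eq_of_mul_eq_mul_left hp.pos ?_
      rw [← mul_assoc, ← pow_succ', hmul, sq]
    exact Dvd.intro_left _ h2
  exact (Group.isSolvable_iff_subgroup_quotient N).2
    ⟨hNs, isSolvable_of_ncard_solubilizer_dvd_prime hp (x : G ⧸ N) hTp⟩
end
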